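/- There exists C > 0 such that for every u ∈ X^{0,1/2,1} and every dyadic number L ≥ 1, ‖χ(Lt)u‖_{X^{0,1/2,1}} ≤ C ‖u‖_{X^{0,1/2,1}}. -/

import Mathlib

open MeasureTheory Complex Real Set Filter
open scoped ENNReal NNReal

noncomputable section

/-- **Hypothesis 1**: `p` is the symbol of the dispersive operator `L_{α+1}`
(the Fourier multiplier by `-i p(ξ)`); `p` is an odd real-valued function of class `C¹`
on `ℝ` and `C²` away from the origin, and for `ξ ≥ ξ₀` the first and second derivatives
of `p` are comparable to `ξ^α` and `ξ^(α-1)` respectively. -/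
structure Hyp1 (α ξ₀ c C : ℝ) (p : ℝ → ℝ) : Prop where
  xi0_pos : 0 < ξ₀
  c_pos : 0 < c
  c_le_C : c ≤ C
  smooth1 : ContDiff ℝ 1 p
  smooth2 : ∀ x : ℝ, x ≠ 0 → ContDiffAt ℝ 2 p x
  odd : ∀ x : ℝ, p (-x) = -p x
  deriv_lb : ∀ ξ : ℝ, ξ₀ ≤ ξ → c * ξ ^ α ≤ deriv p ξ
  deriv_ub : ∀ ξ : ℝ, ξ₀ ≤ ξ → deriv p ξ ≤ C * ξ ^ α
  deriv2_lb : ∀ ξ : ℝ, ξ₀ ≤ ξ → c * ξ ^ (α - 1) ≤ deriv (deriv p) ξ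
  deriv2_ub : ∀ ξ : ℝ, ξ₀ ≤ ξ → deriv (deriv p) ξ ≤ C * ξ ^ (α - 1)

/-- The fixed smooth even cutoff function `χ`: `0 ≤ χ ≤ 1`, `χ ≡ 1` on `[-1,1]`,
`supp χ ⊆ [-2,2]`. -/
structure CutoffFun (χ : ℝ → ℝ) : Prop where
  smooth : ContDiff ℝ (⊤ : ℕ∞) χ
  even : ∀ x : ℝ, χ (-x) = χ x
  nonneg : ∀ x : ℝ, 0 ≤ χ x
  le_one : ∀ x : ℝ, χ x ≤ 1
  eq_one : ∀ x ∈ Set.Icc (-1 : ℝ) 1, χ x = 1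
  compact_supp : ∀ x : ℝ, χ x ≠ 0 → x ∈ Set.Icc (-2 : ℝ) 2

/-- The Littlewood–Paley symbol `φ_N`: for a dyadic `N ≥ 1`, `φ_N(ξ) = χ(ξ/N) - χ(2ξ/N)`,
and `φ_0(ξ) = χ(2ξ)`. -/
def lpSymb (χ : ℝ → ℝ) (N ξ : ℝ) : ℝ :=
  if N = 0 then χ (2 * ξ) else χ (ξ / N) - χ (2 * ξ / N)

/-- The Littlewood–Paley projector `P_N`, acting on the (spatial) Fourier coefficients
of a function on the torus. -/
def PN (χ : ℝ → ℝ) (N : ℝ) (u : ℤ → ℂ) : ℤ → ℂ := fun ξ => (lpSymb χ N ξ : ℂ) * u ξ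

/-- Square of the `L²(𝕋)` norm, computed on Fourier coefficients (Parseval). -/
def l2sq (v : ℤ → ℂ) : ℝ := ∑' ξ : ℤ, ‖v ξ‖ ^ 2

/-- `L²(S × 𝕋)` norm of a space-time function given by its spatial Fourier
coefficients `U t ξ`, `S ⊆ ℝ` a set of times. -/
def L2normOn (S : Set ℝ) (U : ℝ → ℤ → ℂ) : ℝ := (∫ t in S, l2sq (U t)) ^ ((1:ℝ)/2)

/-- `L²(ℝ × 𝕋)` norm. -/
def L2full (U : ℝ → ℤ → ℂ) : ℝ := (∫ t : ℝ, l2sq (U t)) ^ ((1:ℝ)/2)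

/-- `L^∞(]0,T[; L²(𝕋))` norm. -/
def LinfL2 (T : ℝ) (U : ℝ → ℤ → ℂ) : ℝ := ⨆ t : Set.Ioo (0:ℝ) T, (l2sq (U t)) ^ ((1:ℝ)/2)

/-- Membership in `L²(ℝ × 𝕋)`. -/
def MemL2 (U : ℝ → ℤ → ℂ) : Prop :=
  (∀ t : ℝ, Summable fun ξ : ℤ => ‖U t ξ‖ ^ 2) ∧
  (∀ ξ : ℤ, Measurable fun t : ℝ => U t ξ) ∧
  Integrable (fun t : ℝ => l2sq (U t))

/-- Membership in `L^∞(]0,T[; L²(𝕋))`, together with measurability of the coefficients. -/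
def MemLinfL2 (T : ℝ) (U : ℝ → ℤ → ℂ) : Prop :=
  (∀ t ∈ Set.Ioo (0:ℝ) T, Summable fun ξ : ℤ => ‖U t ξ‖ ^ 2) ∧
  (∀ ξ : ℤ, Measurable fun t : ℝ => U t ξ) ∧
  (∃ M : ℝ, ∀ t ∈ Set.Ioo (0:ℝ) T, l2sq (U t) ≤ M)

/-- Continuity with values in `L²(𝕋)` on `[0,T]`. -/
def ContL2On (T : ℝ) (U : ℝ → ℤ → ℂ) : Prop :=
  ∀ t₀ ∈ Set.Icc (0:ℝ) T,
    Filter.Tendsto (fun t => l2sq (fun ξ => U t ξ - U t₀ ξ))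
      (nhdsWithin t₀ (Set.Icc (0:ℝ) T)) (nhds 0)

/-- Time Fourier transform (with the convention `∫ e^{-iτt} g(t) dt`). -/
def FT (g : ℝ → ℂ) (τ : ℝ) : ℂ := ∫ t : ℝ, Complex.exp (-(Complex.I * τ * t)) * g t

/-- Inverse time Fourier transform. -/
def IFT (g : ℝ → ℂ) (t : ℝ) : ℂ :=
  (2 * Real.pi)⁻¹ • ∫ τ : ℝ, Complex.exp (Complex.I * τ * t) * g τ

/-- The modulation projector `Q_L`, a space-time Fourier multiplier with symbol
`ψ_L(τ,ξ) = φ_L(τ - p(ξ))` (acting on spatial Fourier coefficients `U t ξ`). -/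
def QL (χ p : ℝ → ℝ) (L : ℝ) (U : ℝ → ℤ → ℂ) : ℝ → ℤ → ℂ := fun t ξ =>
  IFT (fun τ => (lpSymb χ L (τ - p ξ) : ℂ) * FT (fun s => U s ξ) τ) t

/-- `Q_{≤ 2^l} = Q_0 + ∑_{j ≤ l} Q_{2^j}`. -/
def Qle (χ p : ℝ → ℝ) (l : ℕ) (U : ℝ → ℤ → ℂ) : ℝ → ℤ → ℂ := fun t ξ =>
  QL χ p 0 U t ξ + ∑ j ∈ Finset.range (l + 1), QL χ p ((2:ℝ) ^ j) U t ξ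

/-- The `X^{0,1/2,1}` (Besov–Bourgain) norm:
`‖u‖ = ∑_L max(L,1)^{1/2} ‖Q_L u‖_{L²(ℝ×𝕋)}`, `L` running over `{0} ∪ 2^ℕ`. -/
def Xhalf (χ p : ℝ → ℝ) (U : ℝ → ℤ → ℂ) : ℝ :=
  L2full (QL χ p 0 U) + ∑' l : ℕ, ((2:ℝ) ^ l) ^ ((1:ℝ)/2) * L2full (QL χ p ((2:ℝ) ^ l) U)

/-- Membership in `X^{0,1/2,1}` (with the regularity needed for all the
norms entering the statements to be given by genuinely convergent sums and
integrals). -/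
def MemX (χ p : ℝ → ℝ) (U : ℝ → ℤ → ℂ) : Prop :=
  (∀ ξ : ℤ, Measurable fun t : ℝ => U t ξ) ∧
  (∀ ξ : ℤ, Integrable fun t : ℝ => U t ξ) ∧
  (∀ t : ℝ, Summable fun ξ : ℤ => ‖QL χ p 0 U t ξ‖ ^ 2) ∧
  (∀ l : ℕ, ∀ t : ℝ, Summable fun ξ : ℤ => ‖QL χ p ((2:ℝ) ^ l) U t ξ‖ ^ 2) ∧
  Integrable (fun t : ℝ => l2sq (QL χ p 0 U t)) ∧
  (∀ l : ℕ, Integrable fun t : ℝ => l2sq (QL χ p ((2:ℝ) ^ l) U t)) ∧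
  Summable (fun l : ℕ => ((2:ℝ) ^ l) ^ ((1:ℝ)/2) * L2full (QL χ p ((2:ℝ) ^ l) U))

/-- The bilinear operator `Λ_a`:
`(Λ_a(u,v))^(ξ) = ∑_{ξ₁+ξ₂=ξ} a(ξ₁,ξ₂) û(ξ₁) v̂(ξ₂)`. -/
def Lam (a : ℝ → ℝ → ℂ) (u v : ℤ → ℂ) : ℤ → ℂ := fun ξ =>
  ∑' ξ₁ : ℤ, a ξ₁ ((ξ : ℝ) - ξ₁) * u ξ₁ * v (ξ - ξ₁)

/-- `u` solves `∂_t u + L_{α+1} u + ∂_x f = 0` on `]0,T[ × 𝕋` (in the distributional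
sense), formulated equivalently through the Duhamel formula on each spatial Fourier
mode; `U` and `F` are the spatial Fourier coefficients of `u` and `f`. -/
def Solves (p : ℝ → ℝ) (T : ℝ) (U F : ℝ → ℤ → ℂ) : Prop :=
  ∀ ξ : ℤ, ∀ t ∈ Set.Icc (0:ℝ) T,
    U t ξ = Complex.exp (Complex.I * (p ξ) * t) * U 0 ξ -
      ∫ s in (0:ℝ)..t,
        Complex.exp (Complex.I * (p ξ) * (t - s)) * (Complex.I * (ξ:ℂ)) * F s ξ

/-- Fourier coefficients of the free evolution `e^{-tL_{α+1}} φ`. -/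
def freeEvol (p : ℝ → ℝ) (φ : ℤ → ℂ) : ℝ → ℤ → ℂ := fun t ξ =>
  Complex.exp (Complex.I * (p ξ) * t) * φ ξ



open FourierTransform SchwartzMap in
lemma plancherel_aux (f : ℝ → ℂ) (h1 : Integrable f) (h2 : MemLp f 2) :
    ∫⁻ x, ‖𝓕 f x‖ₑ ^ 2 = ∫⁻ x, ‖f x‖ₑ ^ 2 := by
  have hcont : Continuous (𝓕 f) :=
    VectorFourier.fourierIntegral_continuous Real.continuous_fourierChar
      (by exact continuous_inner) h1
  have key : ((𝓕 (h2.toLp f) : Lp (α := ℝ) ℂ 2 volume) : ℝ → ℂ) =ᵐ[volume] 𝓕 f := by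
    apply ae_eq_of_integral_contDiff_smul_eq
    · exact (Lp.memLp _).locallyIntegrable (by norm_num)
    · exact hcont.locallyIntegrable
    intro g g_smooth g_cpt
    have hg₁ : HasCompactSupport (Complex.ofRealCLM ∘ g) := g_cpt.comp_left rfl
    have hg₂ : ContDiff ℝ (⊤ : ℕ∞) (Complex.ofRealCLM ∘ g) := by fun_prop
    have e1 := congrArg (fun T => T (hg₁.toSchwartzMap hg₂))
      (Lp.fourier_toTemperedDistribution_eq (h2.toLp f))
    simp only [TemperedDistribution.fourier_apply, Lp.toTemperedDistribution_apply] at e1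
    have e2 := VectorFourier.integral_fourierIntegral_smul_eq_flip (μ := volume) (ν := volume)
      (L := innerₗ ℝ) (f := (hg₁.toSchwartzMap hg₂ : ℝ → ℂ)) (g := f)
      Real.continuous_fourierChar (by exact continuous_inner)
      (SchwartzMap.integrable _) h1
    have e3 : ∫ x, (𝓕 (hg₁.toSchwartzMap hg₂)) x • (h2.toLp f) x
       = ∫ x, (𝓕 (hg₁.toSchwartzMap hg₂)) x • f x := by
      apply integral_congr_ae
      filter_upwards [h2.coeFn_toLp] with x hx
      rw [hx]
    rw [e3] at e1
    rw [flip_innerₗ] at e2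
    calc _ = _ := e1.symm
      _ = _ := e2
      _ = _ := rfl
  have e := Lp.norm_fourier_eq (h2.toLp f)
  rw [Lp.norm_def, Lp.norm_def, ENNReal.toReal_eq_toReal_iff' (Lp.eLpNorm_ne_top _)
    (Lp.eLpNorm_ne_top _), eLpNorm_congr_ae key, eLpNorm_congr_ae h2.coeFn_toLp,
    eLpNorm_eq_lintegral_rpow_enorm_toReal (by norm_num) (by norm_num),
    eLpNorm_eq_lintegral_rpow_enorm_toReal (by norm_num) (by norm_num)] at e
  have e' := ENNReal.rpow_left_injective (x := 1 / (2:ℝ≥0∞).toReal) (by norm_num) e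
  simpa using e'

open FourierTransform in
lemma FT_eq (g : ℝ → ℂ) (τ : ℝ) : FT g τ = 𝓕 g (τ / (2 * π)) := by
  rw [FT, Real.fourier_real_eq_integral_exp_smul]
  refine integral_congr_ae (ae_of_all _ fun t => ?_)
  simp only [smul_eq_mul]
  congr 2
  push_cast
  have : (π : ℂ) ≠ 0 := by exact_mod_cast Real.pi_ne_zero
  field_simp

open FourierTransform in
lemma IFT_eq (g : ℝ → ℂ) (t : ℝ) : IFT g t = (2 * π)⁻¹ • 𝓕 g (-(2 * π)⁻¹ * t) := by
  rw [IFT, Real.fourier_real_eq_integral_exp_smul]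
  congr 1
  refine integral_congr_ae (ae_of_all _ fun t => ?_)
  simp only [smul_eq_mul]
  congr 2
  push_cast
  have : (π : ℂ) ≠ 0 := by exact_mod_cast Real.pi_ne_zero
  field_simp

open FourierTransform in
lemma continuous_fourier_aux {f : ℝ → ℂ} (h1 : Integrable f) : Continuous (𝓕 f) :=
    VectorFourier.fourierIntegral_continuous Real.continuous_fourierChar
      (by exact continuous_inner) h1

lemma continuous_FT {f : ℝ → ℂ} (h1 : Integrable f) : Continuous (FT f) := by
  have : FT f = fun τ => FourierTransform.fourier f (τ / (2 * π)) := funext (FT_eq f)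
  rw [this]
  exact (continuous_fourier_aux h1).comp (by fun_prop)

lemma continuous_IFT {f : ℝ → ℂ} (h1 : Integrable f) : Continuous (IFT f) := by
  have : IFT f = fun t => (2 * π)⁻¹ • FourierTransform.fourier f (-(2 * π)⁻¹ * t) :=
    funext (IFT_eq f)
  rw [this]
  have h2 : Continuous fun t : ℝ => -(2 * π)⁻¹ * t := by fun_prop
  exact ((continuous_fourier_aux h1).comp h2).const_smul ((2 * π)⁻¹ : ℝ)

lemma lintegral_scale (f : ℝ → ℝ≥0∞) {a : ℝ} (ha : a ≠ 0) :
    ∫⁻ x, f (a * x) = ENNReal.ofReal |a⁻¹| * ∫⁻ x, f x := by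
  have h := (Homeomorph.mulLeft₀ a ha).measurableEmbedding.lintegral_map (μ := volume) f
  have h2 : Measure.map (Homeomorph.mulLeft₀ a ha) volume = ENNReal.ofReal |a⁻¹| • volume := by
    simpa using Real.map_volume_mul_left ha
  rw [h2, lintegral_smul_measure] at h
  simpa using h.symm

/-- Plancherel for `IFT`. -/
lemma plancherel_IFT (f : ℝ → ℂ) (h1 : Integrable f) (h2 : MemLp f 2) :
    ∫⁻ x, ‖IFT f x‖ₑ ^ 2 = ENNReal.ofReal ((2 * π)⁻¹) * ∫⁻ x, ‖f x‖ₑ ^ 2 := by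
  have hpi : 0 < 2 * π := by positivity
  simp_rw [IFT_eq, enorm_smul, mul_pow]
  rw [lintegral_const_mul' _ _ (ENNReal.pow_ne_top enorm_ne_top), lintegral_scale (fun x => ‖FourierTransform.fourier f x‖ₑ ^ 2)
    (a := -(2 * π)⁻¹) (by simp [Real.pi_ne_zero]), plancherel_aux f h1 h2, ← mul_assoc]
  congr 1
  rw [Real.enorm_eq_ofReal (by positivity), ← ENNReal.ofReal_pow (by positivity),
    ← ENNReal.ofReal_mul (by positivity)]
  congr 1
  rw [inv_neg, abs_neg, inv_inv, abs_of_pos hpi]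
  field_simp

/-- `L²(ℤ × ℝ)` norm of nonnegative functions. -/
def nrm (f : ℤ → ℝ → ℝ≥0∞) : ℝ≥0∞ := (∑' ξ, ∫⁻ τ, f ξ τ ^ 2) ^ (1 / 2 : ℝ)

lemma nrm_sq (f : ℤ → ℝ → ℝ≥0∞) : nrm f ^ 2 = ∑' ξ, ∫⁻ τ, f ξ τ ^ 2 := by
  rw [nrm, ← ENNReal.rpow_natCast, ← ENNReal.rpow_mul]
  norm_num

lemma ennreal_sq_le {a b : ℝ≥0∞} (h : a ^ 2 ≤ b ^ 2) : a ≤ b := by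
  by_contra! hlt
  exact absurd h (not_le.mpr (ENNReal.pow_lt_pow_left (by norm_num) hlt))

lemma nrm_le {f : ℤ → ℝ → ℝ≥0∞} {c : ℝ≥0∞} (h : ∑' ξ, ∫⁻ τ, f ξ τ ^ 2 ≤ c ^ 2) :
    nrm f ≤ c := by
  apply ennreal_sq_le
  rwa [nrm_sq]

lemma nrm_mono {f g : ℤ → ℝ → ℝ≥0∞} (h : ∀ ξ τ, f ξ τ ≤ g ξ τ) : nrm f ≤ nrm g := by
  apply nrm_le
  rw [nrm_sq]
  exact ENNReal.tsum_le_tsum fun ξ => lintegral_mono fun τ => by gcongr; exact h ξ τ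

lemma measurable_unc {f : ℤ → ℝ → ℝ≥0∞} (hf : ∀ ξ, Measurable (f ξ)) :
    Measurable (fun z : ℤ × ℝ => f z.1 z.2) :=
  measurable_from_prod_countable_right hf

lemma nrm_eq {f : ℤ → ℝ → ℝ≥0∞} (hf : ∀ ξ, Measurable (f ξ)) :
    nrm f = (∫⁻ z, (fun z : ℤ × ℝ => f z.1 z.2) z ^ (2 : ℝ)
      ∂((Measure.count : Measure ℤ).prod volume)) ^ (1 / (2 : ℝ)) := by
  rw [nrm, lintegral_prod _ ((measurable_unc hf).pow_const _).aemeasurable, lintegral_count]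
  simp

lemma nrm_add_le {f g : ℤ → ℝ → ℝ≥0∞} (hf : ∀ ξ, Measurable (f ξ))
    (hg : ∀ ξ, Measurable (g ξ)) :
    nrm (fun ξ τ => f ξ τ + g ξ τ) ≤ nrm f + nrm g := by
  rw [nrm_eq hf, nrm_eq hg, nrm_eq (f := fun ξ τ => f ξ τ + g ξ τ) (fun ξ => (hf ξ).add (hg ξ))]
  exact ENNReal.lintegral_Lp_add_le (measurable_unc hf).aemeasurable
    (measurable_unc hg).aemeasurable (by norm_num)

lemma nrm_sum_le {f : ℕ → ℤ → ℝ → ℝ≥0∞} (hf : ∀ j ξ, Measurable (f j ξ)) (n : ℕ) :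
    nrm (fun ξ τ => ∑ j ∈ Finset.range n, f j ξ τ) ≤ ∑ j ∈ Finset.range n, nrm (f j) := by
  induction n with
  | zero => simp [nrm]
  | succ n ih =>
    simp_rw [Finset.sum_range_succ]
    exact (nrm_add_le (fun ξ => Finset.measurable_sum _ fun j _ => hf j ξ) (hf n)).trans
      (by gcongr)

lemma nrm_tsum_le {f : ℕ → ℤ → ℝ → ℝ≥0∞} (hf : ∀ j ξ, Measurable (f j ξ)) :
    nrm (fun ξ τ => ∑' j, f j ξ τ) ≤ ∑' j, nrm (f j) := by
  have hm : ∀ n ξ, Measurable (fun τ => ∑ j ∈ Finset.range n, f j ξ τ) :=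
    fun n ξ => Finset.measurable_sum _ fun j _ => hf j ξ
  rw [nrm_eq (fun ξ => Measurable.tsum fun j => hf j ξ)]
  have ht : Tendsto (fun n => nrm (fun ξ τ => ∑ j ∈ Finset.range n, f j ξ τ)) atTop
      (nhds ((∫⁻ z, (fun z : ℤ × ℝ => ∑' j, f j z.1 z.2) z ^ (2 : ℝ)
      ∂((Measure.count : Measure ℤ).prod volume)) ^ (1 / (2 : ℝ)))) := by
    simp_rw [nrm_eq (hm _)]
    refine (ENNReal.continuous_rpow_const.tendsto _).comp ?_
    refine lintegral_tendsto_of_tendsto_of_monotone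
      (fun n => ((measurable_unc (hm n)).pow_const _).aemeasurable) ?_ ?_
    · refine ae_of_all _ fun z m n hmn => ?_
      simp only
      gcongr
    · refine ae_of_all _ fun z => ?_
      exact (ENNReal.continuous_rpow_const.tendsto _).comp (ENNReal.tendsto_nat_tsum _)
  refine le_of_tendsto' ht fun n => (nrm_sum_le hf n).trans ?_
  exact ENNReal.sum_le_tsum _

lemma cs_ineq {f g : ℝ → ℝ≥0∞} (hf : Measurable f) (hg : Measurable g) :
    (∫⁻ x, f x * g x) ^ 2 ≤ (∫⁻ x, f x ^ 2) * ∫⁻ x, g x ^ 2 := by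
  have h := ENNReal.lintegral_mul_le_Lp_mul_Lq volume (p := 2) (q := 2)
    (by constructor <;> norm_num) hf.aemeasurable hg.aemeasurable
  calc _ ≤ ((∫⁻ x, f x ^ (2:ℝ)) ^ (1 / (2:ℝ)) * (∫⁻ x, g x ^ (2:ℝ)) ^ (1 / (2:ℝ))) ^ 2 := by
        gcongr
        exact h
    _ = _ := by
      rw [mul_pow, ← ENNReal.rpow_natCast, ← ENNReal.rpow_mul, ← ENNReal.rpow_natCast,
        ← ENNReal.rpow_mul]
      norm_num

lemma schur_bound {k h : ℝ → ℝ≥0∞} (hk : Measurable k) (hh : Measurable h) :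
    ∫⁻ τ, (∫⁻ σ, k (τ - σ) * h σ) ^ 2 ≤ (∫⁻ σ, k σ) ^ 2 * ∫⁻ σ, h σ ^ 2 := by
  have hhalf : ∀ y : ℝ≥0∞, y ^ (1 / 2 : ℝ) * y ^ (1 / 2 : ℝ) = y := fun y => by
    rw [← ENNReal.rpow_add_of_nonneg _ _ (by norm_num) (by norm_num)]; norm_num
  have hpt : ∀ τ, (∫⁻ σ, k (τ - σ) * h σ) ^ 2 ≤ (∫⁻ σ, k σ) * ∫⁻ σ, k (τ - σ) * h σ ^ 2 := by
    intro τ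
    have hkm : Measurable fun σ => k (τ - σ) ^ (1 / 2 : ℝ) :=
      (hk.comp (measurable_const.sub measurable_id)).pow_const _
    calc (∫⁻ σ, k (τ - σ) * h σ) ^ 2
        = (∫⁻ σ, k (τ - σ) ^ (1 / 2 : ℝ) * (k (τ - σ) ^ (1 / 2 : ℝ) * h σ)) ^ 2 := by
          simp_rw [← mul_assoc, hhalf]
      _ ≤ _ := cs_ineq hkm (hkm.mul hh)
      _ = _ := by
        simp_rw [mul_pow, sq (k _ ^ (1 / 2 : ℝ)), hhalf]
        congr 1
        exact lintegral_sub_left_eq_self k τ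
  have hm : Measurable (fun z : ℝ × ℝ => k (z.1 - z.2) * h z.2 ^ 2) :=
    (hk.comp (measurable_fst.sub measurable_snd)).mul ((hh.comp measurable_snd).pow_const _)
  calc _ ≤ ∫⁻ τ, (∫⁻ σ, k σ) * ∫⁻ σ, k (τ - σ) * h σ ^ 2 := lintegral_mono hpt
    _ = (∫⁻ σ, k σ) * ∫⁻ τ, ∫⁻ σ, k (τ - σ) * h σ ^ 2 :=
        lintegral_const_mul _ hm.lintegral_prod_right'
    _ = (∫⁻ σ, k σ) * ∫⁻ σ, ∫⁻ τ, k (τ - σ) * h σ ^ 2 := by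
        rw [lintegral_lintegral_swap hm.aemeasurable]
    _ = (∫⁻ σ, k σ) * ∫⁻ σ, (∫⁻ τ, k τ) * h σ ^ 2 := by
        congr 1
        refine lintegral_congr fun σ => ?_
        have hk2 : Measurable fun τ => k (τ - σ) := hk.comp (measurable_id.sub measurable_const)
        rw [lintegral_mul_const _ hk2, lintegral_sub_right_eq_self k σ]
    _ = _ := by rw [lintegral_const_mul _ (hh.pow_const _)]; ring

lemma hs_bound {k h a : ℝ → ℝ≥0∞} (hh : Measurable h) {s : ℝ≥0∞}
    {i j : ℕ} (ha1 : ∀ τ, a τ ≤ 1) (ha : ∀ τ, a τ ≠ 0 → |τ| ≤ 2 ^ i)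
    (hhs : ∀ σ, h σ ≠ 0 → |σ| ≤ 2 ^ j)
    (hks : ∀ τ σ, a τ ≠ 0 → h σ ≠ 0 → k (τ - σ) ≤ s) :
    ∫⁻ τ, (a τ * ∫⁻ σ, k (τ - σ) * h σ) ^ 2 ≤
      s ^ 2 * (2 * 2 ^ i) * (2 * 2 ^ j) * ∫⁻ σ, h σ ^ 2 := by
  have hvol : ∀ n : ℕ, volume (Set.Icc (-(2:ℝ) ^ n) (2 ^ n)) = 2 * 2 ^ n := by
    intro n
    rw [Real.volume_Icc, sub_neg_eq_add, ← two_mul, ENNReal.ofReal_mul (by norm_num),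
      ENNReal.ofReal_pow (by norm_num)]
    simp
  have hind : ∀ n : ℕ, ∫⁻ τ, (Set.Icc (-(2:ℝ) ^ n) (2 ^ n)).indicator
      (fun _ => (1 : ℝ≥0∞)) τ ^ 2 = 2 * 2 ^ n := by
    intro n
    rw [← hvol, ← lintegral_indicator_one measurableSet_Icc]
    refine lintegral_congr fun τ => ?_
    by_cases hτ : τ ∈ Set.Icc (-(2:ℝ) ^ n) (2 ^ n) <;> simp [hτ]
  have h1 : (∫⁻ σ, h σ) ^ 2 ≤ (2 * 2 ^ j) * ∫⁻ σ, h σ ^ 2 := by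
    have := cs_ineq (f := (Set.Icc (-(2:ℝ) ^ j) (2 ^ j)).indicator (fun _ => (1 : ℝ≥0∞)))
      (measurable_const.indicator measurableSet_Icc) hh
    rw [hind] at this
    refine le_trans (le_of_eq ?_) this
    congr 1
    refine lintegral_congr fun σ => ?_
    by_cases hσ : σ ∈ Set.Icc (-(2:ℝ) ^ j) (2 ^ j)
    · simp [hσ]
    · have : h σ = 0 := by
        by_contra hne
        exact hσ (abs_le.mp (hhs σ hne))
      simp [this]
  have hpt : ∀ τ, (a τ * ∫⁻ σ, k (τ - σ) * h σ) ^ 2 ≤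
      (s * ∫⁻ σ, h σ) ^ 2 * (Set.Icc (-(2:ℝ) ^ i) (2 ^ i)).indicator
      (fun _ => (1 : ℝ≥0∞)) τ ^ 2 := by
    intro τ
    by_cases hτ : a τ = 0
    · simp [hτ]
    · have hmem : τ ∈ Set.Icc (-(2:ℝ) ^ i) (2 ^ i) := abs_le.mp (ha τ hτ)
      simp only [hmem, Set.indicator_of_mem, one_pow, mul_one]
      refine pow_le_pow_left' ?_ 2
      calc a τ * ∫⁻ σ, k (τ - σ) * h σ ≤ 1 * ∫⁻ σ, s * h σ := by
            gcongr ?_ * ?_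
            · exact ha1 τ
            · refine lintegral_mono fun σ => ?_
              by_cases hσ : h σ = 0
              · simp [hσ]
              · exact mul_le_mul_left (hks τ σ hτ hσ) _
        _ = _ := by rw [one_mul, lintegral_const_mul _ hh]
  calc _ ≤ ∫⁻ τ, (s * ∫⁻ σ, h σ) ^ 2 * (Set.Icc (-(2:ℝ) ^ i) (2 ^ i)).indicator
            (fun _ => (1 : ℝ≥0∞)) τ ^ 2 := lintegral_mono hpt
    _ = (s * ∫⁻ σ, h σ) ^ 2 * (2 * 2 ^ i) := by
        rw [lintegral_const_mul _ ((measurable_const.indicator measurableSet_Icc).pow_const _),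
          hind]
    _ ≤ s ^ 2 * ((2 * 2 ^ j) * ∫⁻ σ, h σ ^ 2) * (2 * 2 ^ i) := by
        rw [mul_pow]; gcongr
    _ = _ := by ring

/-- The square root of two. -/
def rt : ℝ≥0∞ := ENNReal.ofReal (√2)

lemma rt_sq : rt ^ 2 = 2 := by
  rw [rt, ← ENNReal.ofReal_pow (by positivity), Real.sq_sqrt (by norm_num)]; simp

lemma rt_pow_sq (n : ℕ) : (rt ^ n) ^ 2 = 2 ^ n := by
  rw [← pow_mul, mul_comm, pow_mul, rt_sq]

lemma rt_ne_top : rt ≠ ⊤ := ENNReal.ofReal_ne_top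

lemma five_le_rt : 5 ≤ 4 * rt := by
  have : (5:ℝ) ≤ 4 * √2 := by
    have : (5/4:ℝ) ≤ √2 := Real.le_sqrt_of_sq_le (by norm_num)
    linarith
  rw [rt]
  calc (5:ℝ≥0∞) = ENNReal.ofReal 5 := by simp
    _ ≤ ENNReal.ofReal (4 * √2) := ENNReal.ofReal_le_ofReal this
    _ = _ := by rw [ENNReal.ofReal_mul (by norm_num)]; simp

lemma rt_sum (n : ℕ) : ∑ i ∈ Finset.range n, rt ^ i ≤ 4 * rt ^ n := by
  induction n with
  | zero => simp
  | succ n ih =>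
    rw [Finset.sum_range_succ]
    calc _ ≤ 4 * rt ^ n + rt ^ n := by gcongr
      _ = 5 * rt ^ n := by ring
      _ ≤ 4 * rt * rt ^ n := by gcongr; exact five_le_rt
      _ = _ := by ring

lemma peak_sum (l : ℕ) : ∑' i : ℕ, (if i < l then (2:ℝ≥0∞) ^ i * (2 ^ l)⁻¹
    else 2 ^ l * (2 ^ i)⁻¹) ≤ 3 := by
  have hl0 : (2:ℝ≥0∞) ^ l ≠ 0 := by simp
  have hlt : (2:ℝ≥0∞) ^ l ≠ ⊤ := by simp
  have h1 : ∑ i ∈ Finset.range l, (if i < l then (2:ℝ≥0∞) ^ i * (2 ^ l)⁻¹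
    else 2 ^ l * (2 ^ i)⁻¹) ≤ 1 := by
    calc _ = ∑ i ∈ Finset.range l, (2:ℝ≥0∞) ^ i * (2 ^ l)⁻¹ :=
          Finset.sum_congr rfl fun i hi => if_pos (Finset.mem_range.mp hi)
      _ = (∑ i ∈ Finset.range l, (2:ℝ≥0∞) ^ i) * (2 ^ l)⁻¹ := by rw [Finset.sum_mul]
      _ ≤ 2 ^ l * (2 ^ l)⁻¹ := by
          gcongr
          have : ∑ i ∈ Finset.range l, 2 ^ i ≤ 2 ^ l :=
            ((Nat.geomSum_lt (le_refl 2) (s := Finset.range l) (n := l) (by simp))).le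
          exact_mod_cast this
      _ = 1 := ENNReal.mul_inv_cancel hl0 hlt
  have h2 : ∑' i : ℕ, (if i + l < l then (2:ℝ≥0∞) ^ (i + l) * (2 ^ l)⁻¹
    else 2 ^ l * (2 ^ (i + l))⁻¹) = 2 := by
    have : ∀ i : ℕ, (if i + l < l then (2:ℝ≥0∞) ^ (i + l) * (2 ^ l)⁻¹
        else 2 ^ l * (2 ^ (i + l))⁻¹) = (2⁻¹) ^ i := by
      intro i
      rw [if_neg (by omega), pow_add, ENNReal.mul_inv (by simp) (by simp), mul_left_comm,
        ENNReal.mul_inv_cancel hl0 hlt, mul_one, ENNReal.inv_pow]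
    simp_rw [this]
    rw [ENNReal.tsum_geometric, ENNReal.one_sub_inv_two, inv_inv]
  rw [← ENNReal.summable.sum_add_tsum_nat_add' (k := l) (f := fun i : ℕ =>
    (if i < l then (2:ℝ≥0∞) ^ i * (2 ^ l)⁻¹ else 2 ^ l * (2 ^ i)⁻¹)), h2]
  calc _ ≤ (1:ℝ≥0∞) + 2 := by gcongr
    _ = 3 := by norm_num

lemma core_bound {k : ℝ → ℝ≥0∞} {a : ℕ → ℝ → ℝ≥0∞} {F G : ℤ → ℝ → ℝ≥0∞} {A : ℝ≥0∞} (l : ℕ)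
    (hk : Measurable k) (ha : ∀ n, Measurable (a n)) (hG : ∀ ξ, Measurable (G ξ))
    (ha1 : ∀ n τ, a n τ ≤ 1) (hsum : ∀ τ, 1 ≤ ∑' n, a n τ)
    (hup : ∀ n τ, a n τ ≠ 0 → |τ| ≤ 2 ^ n)
    (hlow : ∀ n τ, a (n + 1) τ ≠ 0 → 2 ^ n ≤ 2 * |τ|)
    (hk1 : ∫⁻ σ, k σ ≤ A) (hk2 : ∀ σ, k σ ≤ A * (2 ^ l)⁻¹)
    (hk3 : ∀ (n : ℕ) σ, (2:ℝ) ^ n ≤ 8 * |σ| → k σ ≤ A * (2 ^ l * ((2 ^ n)⁻¹) ^ 2))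
    (hF : ∀ ξ τ, F ξ τ ≤ ∫⁻ σ, k (τ - σ) * G ξ σ) :
    ∑' i, rt ^ i * nrm (fun ξ τ => a i τ * F ξ τ) ≤
      (4 * rt ^ 4 * A + 6 * A) * ∑' j, rt ^ j * nrm (fun ξ τ => a j τ * G ξ τ) := by
  set T : ℕ → ℤ → ℝ → ℝ≥0∞ := fun j ξ τ => ∫⁻ σ, k (τ - σ) * (a j σ * G ξ σ) with hT
  have hTm : ∀ j ξ, Measurable (T j ξ) := by
    intro j ξ
    have hm : Measurable (fun z : ℝ × ℝ => k (z.1 - z.2) * (a j z.2 * G ξ z.2)) :=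
      (hk.comp (measurable_fst.sub measurable_snd)).mul
        (((ha j).comp measurable_snd).mul ((hG ξ).comp measurable_snd))
    exact hm.lintegral_prod_right'
  have hFT : ∀ ξ τ, F ξ τ ≤ ∑' j, T j ξ τ := by
    intro ξ τ
    refine (hF ξ τ).trans ?_
    rw [hT]
    simp only
    rw [← lintegral_tsum]
    · refine lintegral_mono fun σ => ?_
      simp only
      rw [ENNReal.tsum_mul_left, ENNReal.tsum_mul_right]
      gcongr
      calc G ξ σ = 1 * G ξ σ := (one_mul _).symm
        _ ≤ _ := by gcongr; exact hsum σ
    · intro j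
      have hk2 : Measurable fun σ => k (τ - σ) := hk.comp (measurable_const.sub measurable_id)
      exact (hk2.mul ((ha j).mul (hG ξ))).aemeasurable
  have hN : ∀ j, Measurable (a j) := ha
  -- Schur bound
  have B1 : ∀ i j, nrm (fun ξ τ => a i τ * T j ξ τ) ≤ A * nrm (fun ξ τ => a j τ * G ξ τ) := by
    intro i j
    refine (nrm_mono (g := T j) fun ξ τ => ?_).trans ?_
    · calc a i τ * T j ξ τ ≤ 1 * T j ξ τ := by gcongr; exact ha1 i τ
        _ = _ := one_mul _
    · apply nrm_le
      rw [mul_pow, nrm_sq, ← ENNReal.tsum_mul_left]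
      refine ENNReal.tsum_le_tsum fun ξ => ?_
      refine (schur_bound (h := fun σ => a j σ * G ξ σ) hk ((ha j).mul (hG ξ))).trans ?_
      gcongr
  -- Hilbert-Schmidt bound
  have B2 : ∀ i j s, (∀ τ σ, a i τ ≠ 0 → a j σ ≠ 0 → k (τ - σ) ≤ s) →
      nrm (fun ξ τ => a i τ * T j ξ τ) ≤
        (s * 2 * rt ^ i * rt ^ j) * nrm (fun ξ τ => a j τ * G ξ τ) := by
    intro i j s hs
    apply nrm_le
    rw [mul_pow, nrm_sq, ← ENNReal.tsum_mul_left]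
    refine ENNReal.tsum_le_tsum fun ξ => ?_
    refine (hs_bound (k := k) (h := fun σ => a j σ * G ξ σ) (s := s) (i := i) (j := j) (a := a i)
      ((ha j).mul (hG ξ)) (ha1 i) (hup i) ?_ ?_).trans ?_
    · intro σ hσ
      exact hup j σ (left_ne_zero_of_mul hσ)
    · intro τ σ h1 h2
      exact hs τ σ h1 (left_ne_zero_of_mul h2)
    · simp only [mul_pow, rt_pow_sq]
      apply le_of_eq
      ring
  have B3 : ∀ i j, rt ^ i * nrm (fun ξ τ => a i τ * T j ξ τ) ≤
      ((if i < j + 4 then A * rt ^ i else 0) + 2 * A * rt ^ j * 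
        (if i < l then (2:ℝ≥0∞) ^ i * (2 ^ l)⁻¹ else 2 ^ l * (2 ^ i)⁻¹)) *
        nrm (fun ξ τ => a j τ * G ξ τ) := by
    intro i j
    by_cases hij : i < j + 4
    · rw [if_pos hij]
      calc _ ≤ rt ^ i * (A * nrm (fun ξ τ => a j τ * G ξ τ)) := by gcongr; exact B1 i j
        _ = (A * rt ^ i + 0) * nrm (fun ξ τ => a j τ * G ξ τ) := by ring
        _ ≤ _ := by gcongr; exact zero_le
    · rw [if_neg hij, zero_add]
      split_ifs with hil
      · calc _ ≤ rt ^ i * ((A * (2 ^ l)⁻¹ * 2 * rt ^ i * rt ^ j) *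
              nrm (fun ξ τ => a j τ * G ξ τ)) := by
              gcongr
              exact B2 i j _ fun τ σ _ _ => hk2 _
          _ = 2 * A * rt ^ j * ((rt ^ i) ^ 2 * (2 ^ l)⁻¹) *
              nrm (fun ξ τ => a j τ * G ξ τ) := by ring
          _ = _ := by rw [rt_pow_sq]
      · calc _ ≤ rt ^ i * ((A * (2 ^ l * ((2 ^ i)⁻¹) ^ 2) * 2 * rt ^ i * rt ^ j) *
              nrm (fun ξ τ => a j τ * G ξ τ)) := by
              gcongr
              refine B2 i j _ fun τ σ h1 h2 => hk3 i _ ?_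
              obtain ⟨m, rfl⟩ : ∃ m, i = j + 4 + m := ⟨i - (j + 4), by omega⟩
              have e1 := hlow (j + 3 + m) τ (by convert h1 using 2; omega)
              have e2 := hup j σ h2
              have e3 := abs_sub_abs_le_abs_sub τ σ
              have e4 : (1:ℝ) ≤ 2 ^ m := one_le_pow₀ (by norm_num)
              have e5 : (0:ℝ) < 2 ^ j := by positivity
              have e6 : (2:ℝ) ^ j ≤ 2 ^ j * 2 ^ m := by nlinarith
              have e7 : (2:ℝ) ^ (j + 3 + m) = 8 * (2 ^ j * 2 ^ m) := by
                rw [pow_add, pow_add]; ring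
              have e8 : (2:ℝ) ^ (j + 4 + m) = 16 * (2 ^ j * 2 ^ m) := by
                rw [pow_add, pow_add]; ring
              rw [e7] at e1
              rw [e8]
              linarith
          _ = 2 * A * rt ^ j * (2 ^ l * (((rt ^ i) ^ 2 * (2 ^ i)⁻¹) * (2 ^ i)⁻¹)) *
              nrm (fun ξ τ => a j τ * G ξ τ) := by ring
          _ = _ := by
              rw [rt_pow_sq, ENNReal.mul_inv_cancel (by simp) (by simp), one_mul]
  have hstep : ∀ i, rt ^ i * nrm (fun ξ τ => a i τ * F ξ τ) ≤
      ∑' j, rt ^ i * nrm (fun ξ τ => a i τ * T j ξ τ) := by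
    intro i
    rw [ENNReal.tsum_mul_left]
    gcongr
    refine (nrm_mono fun ξ τ => ?_).trans
      (nrm_tsum_le (f := fun j ξ τ => a i τ * T j ξ τ) fun j ξ => (ha i).mul (hTm j ξ))
    rw [ENNReal.tsum_mul_left]
    gcongr
    exact hFT ξ τ
  calc _ ≤ ∑' i, ∑' j, rt ^ i * nrm (fun ξ τ => a i τ * T j ξ τ) :=
        ENNReal.tsum_le_tsum hstep
    _ = ∑' j, ∑' i, rt ^ i * nrm (fun ξ τ => a i τ * T j ξ τ) := ENNReal.tsum_comm
    _ ≤ ∑' j, (4 * rt ^ 4 * A + 6 * A) * (rt ^ j * nrm (fun ξ τ => a j τ * G ξ τ)) := by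
        refine ENNReal.tsum_le_tsum fun j => ?_
        refine (ENNReal.tsum_le_tsum fun i => B3 i j).trans ?_
        rw [ENNReal.tsum_mul_right, ENNReal.tsum_add, ENNReal.tsum_mul_left, ← mul_assoc]
        gcongr
        have h1 : ∑' i, (if i < j + 4 then A * rt ^ i else 0) ≤ A * (4 * rt ^ (j + 4)) := by
          rw [tsum_eq_sum (s := Finset.range (j + 4))]
          · rw [Finset.sum_congr rfl fun i hi => if_pos (Finset.mem_range.mp hi),
              ← Finset.mul_sum]
            gcongr
            exact rt_sum _
          · intro i hi
            rw [if_neg (by simpa using hi)]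
        calc _ ≤ A * (4 * rt ^ (j + 4)) + 2 * A * rt ^ j * 3 := by
              gcongr
              exact peak_sum l
          _ = _ := by ring
    _ = _ := ENNReal.tsum_mul_left

open FourierTransform SchwartzMap in
/-- Fourier representation of the cutoff with a rapidly decaying density. -/
lemma cutoff_repr {χ : ℝ → ℝ} (hχ : CutoffFun χ) :
    ∃ (H : ℝ → ℂ) (D : ℝ), Continuous H ∧ Integrable H ∧ 0 ≤ D ∧ (∀ v, ‖H v‖ ≤ D) ∧
      (∀ v, v ^ 2 * ‖H v‖ ≤ D) ∧
      ∀ s : ℝ, (χ s : ℂ) = ∫ v : ℝ, Complex.exp ((2 * π * v * s : ℝ) * Complex.I) * H v := by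
  have hc : HasCompactSupport χ := by
    refine HasCompactSupport.intro (isCompact_Icc (a := (-2:ℝ)) (b := 2)) fun x hx => ?_
    by_contra h
    exact hx (hχ.compact_supp x h)
  have hsm := hχ.smooth
  have h₁ : HasCompactSupport (Complex.ofRealCLM ∘ χ) := hc.comp_left rfl
  have h₂ : ContDiff ℝ (⊤ : ℕ∞) (Complex.ofRealCLM ∘ χ) := by fun_prop
  set f : 𝓢(ℝ, ℂ) := h₁.toSchwartzMap h₂ with hf
  obtain ⟨D1, hD1, h1⟩ := (𝓕 f).decay 0 0
  obtain ⟨D2, hD2, h2⟩ := (𝓕 f).decay 2 0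
  refine ⟨((𝓕 f : 𝓢(ℝ, ℂ)) : ℝ → ℂ), max D1 D2, (𝓕 f).continuous, (𝓕 f).integrable, le_max_of_le_left hD1.le,
    ?_, ?_, ?_⟩
  · intro v
    refine le_trans ?_ (le_max_left _ _)
    simpa using h1 v
  · intro v
    refine le_trans ?_ (le_max_right _ _)
    simpa using h2 v
  · intro s
    have e : 𝓕⁻ (𝓕 f) s = f s := by simp
    rw [SchwartzMap.fourierInv_coe, Real.fourierInv_eq'] at e
    have e2 : f s = (χ s : ℂ) := rfl
    rw [← e2, ← e]
    refine integral_congr_ae (ae_of_all _ fun v => ?_)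
    simp only [smul_eq_mul]
    congr 3
    simp only [RCLike.inner_apply, conj_trivial]
    push_cast
    ring

lemma FT_mul_cutoff {χ : ℝ → ℝ} {H : ℝ → ℂ} (hH : Integrable H)
    (hr : ∀ s : ℝ, (χ s : ℂ) = ∫ v : ℝ, Complex.exp ((2 * π * v * s : ℝ) * Complex.I) * H v)
    (M : ℝ) {u : ℝ → ℂ} (hu : Integrable u) (τ : ℝ) :
    FT (fun t => (χ (M * t) : ℂ) * u t) τ = ∫ v, H v * FT u (τ - 2 * π * M * v) := by
  simp only [FT]
  have hIntg : Integrable (fun z : ℝ × ℝ =>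
      Complex.exp ((-τ * z.1 + 2 * π * z.2 * (M * z.1) : ℝ) * Complex.I) * (u z.1 * H z.2))
      (volume.prod volume) := by
    refine (hu.mul_prod hH).bdd_mul (c := 1) ?_ ?_
    · exact (by fun_prop : Continuous fun z : ℝ × ℝ =>
        Complex.exp ((-τ * z.1 + 2 * π * z.2 * (M * z.1) : ℝ) * Complex.I)).aestronglyMeasurable
    · exact ae_of_all _ fun z => by rw [Complex.norm_exp_ofReal_mul_I]
  calc _ = ∫ t : ℝ, ∫ v : ℝ,
        Complex.exp ((-τ * t + 2 * π * v * (M * t) : ℝ) * Complex.I) * (u t * H v) := by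
        refine integral_congr_ae (ae_of_all _ fun t => ?_)
        simp only
        rw [hr, ← integral_mul_const, ← integral_const_mul]
        refine integral_congr_ae (ae_of_all _ fun v => ?_)
        simp only
        have : Complex.exp ((-τ * t + 2 * π * v * (M * t) : ℝ) * Complex.I) =
            Complex.exp (-(Complex.I * τ * t)) *
              Complex.exp ((2 * π * v * (M * t) : ℝ) * Complex.I) := by
          rw [← Complex.exp_add]
          congr 1
          push_cast
          ring
        rw [this]
        ring
    _ = ∫ v : ℝ, ∫ t : ℝ,
        Complex.exp ((-τ * t + 2 * π * v * (M * t) : ℝ) * Complex.I) * (u t * H v) :=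
        integral_integral_swap hIntg
    _ = _ := by
        refine integral_congr_ae (ae_of_all _ fun v => ?_)
        simp only
        rw [← integral_const_mul]
        refine integral_congr_ae (ae_of_all _ fun t => ?_)
        simp only
        have : Complex.exp ((-τ * t + 2 * π * v * (M * t) : ℝ) * Complex.I) =
            Complex.exp (-(Complex.I * (τ - 2 * π * M * v : ℝ) * t)) := by
          congr 1
          push_cast
          ring
        rw [this]
        ring

/-- The rescaled kernel. -/
def kern (H : ℝ → ℂ) (l : ℕ) (σ : ℝ) : ℝ≥0∞ :=
  ENNReal.ofReal ((2 * π * 2 ^ l)⁻¹) * ‖H ((2 * π * 2 ^ l)⁻¹ * σ)‖ₑ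

lemma FT_cutoff_le {χ : ℝ → ℝ} {H : ℝ → ℂ} (hH : Integrable H)
    (hr : ∀ s : ℝ, (χ s : ℂ) = ∫ v : ℝ, Complex.exp ((2 * π * v * s : ℝ) * Complex.I) * H v)
    (l : ℕ) {u : ℝ → ℂ} (hu : Integrable u) (q τ : ℝ) :
    ‖FT (fun t => (χ (2 ^ l * t) : ℂ) * u t) (τ + q)‖ₑ ≤
      ∫⁻ σ, kern H l (τ - σ) * ‖FT u (σ + q)‖ₑ := by
  have hb : 0 < 2 * π * 2 ^ l := by positivity
  rw [FT_mul_cutoff hH hr _ hu]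
  refine (enorm_integral_le_lintegral_enorm _).trans (le_of_eq ?_)
  have h1 := lintegral_scale (fun σ => ‖H ((2 * π * 2 ^ l)⁻¹ * σ)‖ₑ * ‖FT u (τ + q - σ)‖ₑ) hb.ne'
  rw [← lintegral_sub_left_eq_self (fun σ => kern H l (τ - σ) * ‖FT u (σ + q)‖ₑ) τ]
  simp only [kern, mul_assoc (ENNReal.ofReal _)]
  rw [lintegral_const_mul' _ _ ENNReal.ofReal_ne_top]
  rw [abs_of_pos (inv_pos.mpr hb)] at h1
  calc _ = _ := lintegral_congr fun v => by
        rw [enorm_mul, inv_mul_cancel_left₀ hb.ne']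
    _ = _ := h1
    _ = _ := by
      congr 1
      refine lintegral_congr fun σ => ?_
      congr 3
      · ring
      · ring

lemma kern_measurable {H : ℝ → ℂ} (hH : Continuous H) (l : ℕ) : Measurable (kern H l) := by
  unfold kern
  exact (Continuous.measurable (by fun_prop)).const_mul _

lemma kern_integral (H : ℝ → ℂ) (l : ℕ) : ∫⁻ σ, kern H l σ = ∫⁻ v, ‖H v‖ₑ := by
  have hb : 0 < 2 * π * 2 ^ l := by positivity
  unfold kern
  rw [lintegral_const_mul' _ _ ENNReal.ofReal_ne_top,
    lintegral_scale (fun v => ‖H v‖ₑ) (inv_pos.mpr hb).ne', ← mul_assoc, inv_inv, abs_of_pos hb,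
    ← ENNReal.ofReal_mul (inv_pos.mpr hb).le, inv_mul_cancel₀ hb.ne']
  simp

lemma kern_eq (H : ℝ → ℂ) (l : ℕ) (σ : ℝ) :
    kern H l σ = ENNReal.ofReal ((2 * π * 2 ^ l)⁻¹ * ‖H ((2 * π * 2 ^ l)⁻¹ * σ)‖) := by
  rw [kern, ENNReal.ofReal_mul (by positivity), ofReal_norm]

lemma ofReal_two_pow (n : ℕ) : ENNReal.ofReal (2 ^ n) = 2 ^ n := by
  rw [ENNReal.ofReal_pow (by norm_num)]; simp

lemma ofReal_two_pow_inv (n : ℕ) : ENNReal.ofReal ((2 ^ n)⁻¹) = (2 ^ n)⁻¹ := by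
  rw [ENNReal.ofReal_inv_of_pos (by positivity), ofReal_two_pow]

lemma kern_bound1 {H : ℝ → ℂ} {D : ℝ} (hD : 0 ≤ D) (h1 : ∀ v, ‖H v‖ ≤ D) (l : ℕ) (σ : ℝ) :
    kern H l σ ≤ ENNReal.ofReal (128 * π * D) * (2 ^ l)⁻¹ := by
  rw [kern_eq, ← ofReal_two_pow_inv, ← ENNReal.ofReal_mul (by positivity)]
  apply ENNReal.ofReal_le_ofReal
  have hpi := Real.two_le_pi
  calc _ ≤ (2 * π * 2 ^ l)⁻¹ * D := by gcongr; exact h1 _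
    _ = (2 * π)⁻¹ * D * (2 ^ l)⁻¹ := by rw [mul_inv]; ring
    _ ≤ _ := by
      gcongr
      calc (2 * π)⁻¹ ≤ 1 := inv_le_one_of_one_le₀ (by linarith)
        _ ≤ _ := by linarith

lemma kern_bound2 {H : ℝ → ℂ} {D : ℝ} (hD : 0 ≤ D) (h1 : ∀ v, v ^ 2 * ‖H v‖ ≤ D) (l n : ℕ)
    (σ : ℝ) (hσ : (2:ℝ) ^ n ≤ 8 * |σ|) :
    kern H l σ ≤ ENNReal.ofReal (128 * π * D) * (2 ^ l * ((2 ^ n)⁻¹) ^ 2) := by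
  rw [kern_eq, ← ofReal_two_pow_inv, ← ENNReal.ofReal_pow (by positivity), ← ofReal_two_pow,
    ← ENNReal.ofReal_mul (by positivity), ← ENNReal.ofReal_mul (by positivity)]
  apply ENNReal.ofReal_le_ofReal
  have h := h1 ((2 * π * 2 ^ l)⁻¹ * σ)
  set N := ‖H ((2 * π * 2 ^ l)⁻¹ * σ)‖ with hN
  have hN0 : 0 ≤ N := norm_nonneg _
  have hpi : 0 < π := Real.pi_pos
  have hl : (0:ℝ) < 2 ^ l := by positivity
  have hn : (0:ℝ) < 2 ^ n := by positivity
  have e1 : ((2:ℝ) ^ n) ^ 2 ≤ 64 * σ ^ 2 := by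
    rw [← sq_abs σ]; nlinarith [abs_nonneg σ]
  have e2 : σ ^ 2 * N ≤ D * (2 * π * 2 ^ l) ^ 2 := by
    rw [mul_pow, inv_pow, mul_assoc, inv_mul_le_iff₀ (by positivity)] at h
    linarith
  rw [inv_mul_le_iff₀ (by positivity)]
  rw [inv_pow, ← mul_assoc, ← mul_assoc, le_mul_inv_iff₀ (by positivity)]
  calc N * ((2:ℝ) ^ n) ^ 2 ≤ N * (64 * σ ^ 2) := by gcongr
    _ = 64 * (σ ^ 2 * N) := by ring
    _ ≤ 64 * (D * (2 * π * 2 ^ l) ^ 2) := by gcongr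
    _ = _ := by ring

/-- Dyadic numbers `0, 1, 2, 4, …`. -/
def dy (n : ℕ) : ℝ := if n = 0 then 0 else 2 ^ (n - 1)

lemma lpSymb_zero (χ : ℝ → ℝ) (τ : ℝ) : lpSymb χ (dy 0) τ = χ (2 * τ) := by
  simp [lpSymb, dy]

lemma lpSymb_succ (χ : ℝ → ℝ) (n : ℕ) (τ : ℝ) :
    lpSymb χ (dy (n + 1)) τ = χ (τ / 2 ^ n) - χ (2 * τ / 2 ^ n) := by
  simp [lpSymb, dy]

lemma CutoffFun.zero_of {χ : ℝ → ℝ} (hχ : CutoffFun χ) {x : ℝ} (hx : 2 < |x|) : χ x = 0 := by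
  by_contra h
  exact absurd (abs_le.mpr (hχ.compact_supp x h)) (not_le.mpr hx)

lemma CutoffFun.one_of {χ : ℝ → ℝ} (hχ : CutoffFun χ) {x : ℝ} (hx : |x| ≤ 1) : χ x = 1 :=
  hχ.eq_one x (abs_le.mp hx)

lemma lpSymb_continuous {χ : ℝ → ℝ} (hχ : CutoffFun χ) (n : ℕ) :
    Continuous (lpSymb χ (dy n)) := by
  have hc : Continuous χ := hχ.smooth.continuous
  cases n with
  | zero =>
    rw [funext (lpSymb_zero χ)]
    fun_prop
  | succ n =>
    rw [funext (lpSymb_succ χ n)]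
    fun_prop

lemma lpSymb_abs_le {χ : ℝ → ℝ} (hχ : CutoffFun χ) (n : ℕ) (τ : ℝ) :
    |lpSymb χ (dy n) τ| ≤ 1 := by
  cases n with
  | zero =>
    rw [lpSymb_zero, abs_le]
    constructor <;> linarith [hχ.nonneg (2 * τ), hχ.le_one (2 * τ)]
  | succ n =>
    rw [lpSymb_succ, abs_le]
    constructor <;> linarith [hχ.nonneg (τ / 2 ^ n), hχ.le_one (τ / 2 ^ n),
      hχ.nonneg (2 * τ / 2 ^ n), hχ.le_one (2 * τ / 2 ^ n)]

lemma lpSymb_up {χ : ℝ → ℝ} (hχ : CutoffFun χ) (n : ℕ) (τ : ℝ)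
    (h : lpSymb χ (dy n) τ ≠ 0) : |τ| ≤ 2 ^ n := by
  by_contra! hlt
  apply h
  cases n with
  | zero =>
    rw [lpSymb_zero]
    apply hχ.zero_of
    rw [abs_mul, abs_two]
    norm_num at hlt
    linarith
  | succ n =>
    have hn : (0:ℝ) < 2 ^ n := by positivity
    rw [pow_succ] at hlt
    rw [lpSymb_succ, hχ.zero_of, hχ.zero_of, sub_zero]
    · rw [abs_div, abs_mul, abs_two, abs_of_pos hn, lt_div_iff₀ hn]
      linarith
    · rw [abs_div, abs_of_pos hn, lt_div_iff₀ hn]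
      linarith

lemma lpSymb_low {χ : ℝ → ℝ} (hχ : CutoffFun χ) (n : ℕ) (τ : ℝ)
    (h : lpSymb χ (dy (n + 1)) τ ≠ 0) : 2 ^ n ≤ 2 * |τ| := by
  by_contra! hlt
  apply h
  have hn : (0:ℝ) < 2 ^ n := by positivity
  rw [lpSymb_succ, hχ.one_of, hχ.one_of, sub_self]
  · rw [abs_div, abs_mul, abs_two, abs_of_pos hn, div_le_one hn]
    exact hlt.le
  · rw [abs_div, abs_of_pos hn, div_le_one hn]
    linarith [abs_nonneg τ]

lemma lpSymb_sum (χ : ℝ → ℝ) (n : ℕ) (τ : ℝ) :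
    ∑ i ∈ Finset.range (n + 2), lpSymb χ (dy i) τ = χ (τ / 2 ^ n) := by
  induction n with
  | zero =>
    rw [Finset.sum_range_succ, Finset.sum_range_one, lpSymb_zero, lpSymb_succ]
    simp
  | succ n ih =>
    rw [Finset.sum_range_succ, ih, lpSymb_succ]
    have : 2 * τ / 2 ^ (n + 1) = τ / 2 ^ n := by
      rw [pow_succ]; field_simp
    rw [this]
    ring

lemma lpSymb_tsum {χ : ℝ → ℝ} (hχ : CutoffFun χ) (τ : ℝ) :
    1 ≤ ∑' n, ‖lpSymb χ (dy n) τ‖ₑ := by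
  obtain ⟨n, hn⟩ := pow_unbounded_of_one_lt |τ| (one_lt_two : (1:ℝ) < 2)
  have hp : (0:ℝ) < 2 ^ n := by positivity
  calc (1:ℝ≥0∞) = ‖χ (τ / 2 ^ n)‖ₑ := by
        rw [hχ.one_of]
        · simp
        · rw [abs_div, abs_of_pos hp, div_le_one hp]; exact hn.le
    _ = ‖∑ i ∈ Finset.range (n + 2), lpSymb χ (dy i) τ‖ₑ := by rw [lpSymb_sum]
    _ ≤ ∑ i ∈ Finset.range (n + 2), ‖lpSymb χ (dy i) τ‖ₑ := enorm_sum_le _ _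
    _ ≤ _ := ENNReal.sum_le_tsum _

/-- The shifted Fourier transform, in absolute value. -/
def shG (p : ℝ → ℝ) (U : ℝ → ℤ → ℂ) (ξ : ℤ) (τ : ℝ) : ℝ≥0∞ :=
  ‖FT (fun s => U s ξ) (τ + p ξ)‖ₑ

lemma mult_props {χ : ℝ → ℝ} (hχ : CutoffFun χ) (n : ℕ) (q : ℝ) {u : ℝ → ℂ}
    (hu : Integrable u) :
    Integrable (fun τ => (lpSymb χ (dy n) (τ - q) : ℂ) * FT u τ) ∧
    MemLp (fun τ => (lpSymb χ (dy n) (τ - q) : ℂ) * FT u τ) 2 := by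
  have hc : Continuous (fun τ => (lpSymb χ (dy n) (τ - q) : ℂ) * FT u τ) := by
    have h1 := lpSymb_continuous hχ n
    have h2 := continuous_FT hu
    fun_prop
  have hs : HasCompactSupport (fun τ => (lpSymb χ (dy n) (τ - q) : ℂ) * FT u τ) := by
    refine HasCompactSupport.intro (isCompact_Icc (a := q - 2 ^ n) (b := q + 2 ^ n))
      fun x hx => ?_
    have : lpSymb χ (dy n) (x - q) = 0 := by
      by_contra h
      have := abs_le.mp (lpSymb_up hχ n _ h)
      exact hx ⟨by linarith [this.1], by linarith [this.2]⟩
    simp [this]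
  exact ⟨hc.integrable_of_hasCompactSupport hs, hc.memLp_of_hasCompactSupport hs⟩

lemma lint_QL {χ p : ℝ → ℝ} (hχ : CutoffFun χ) (n : ℕ) {U : ℝ → ℤ → ℂ}
    (hU : ∀ ξ, Integrable fun t => U t ξ) :
    ∫⁻ t, ∑' ξ, ‖QL χ p (dy n) U t ξ‖ₑ ^ 2 =
      ENNReal.ofReal ((2 * π)⁻¹) * nrm (fun ξ τ => ‖lpSymb χ (dy n) τ‖ₑ * shG p U ξ τ) ^ 2 := by
  rw [nrm_sq, ← ENNReal.tsum_mul_left, lintegral_tsum]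
  · refine tsum_congr fun ξ => ?_
    obtain ⟨h1, h2⟩ := mult_props hχ n (p ξ) (hU ξ)
    unfold QL
    rw [plancherel_IFT _ h1 h2]
    congr 1
    rw [← lintegral_add_right_eq_self _ (p ξ)]
    refine lintegral_congr fun τ => ?_
    rw [add_sub_cancel_right, enorm_mul, shG]
    congr 2
    rw [← ofReal_norm, ← ofReal_norm, Complex.norm_real]
  · intro ξ
    obtain ⟨h1, h2⟩ := mult_props hχ n (p ξ) (hU ξ)
    exact ((continuous_IFT h1).measurable.enorm.pow_const 2).aemeasurable

lemma ofReal_tsum_le {ι : Type*} {f : ι → ℝ} (hf : ∀ i, 0 ≤ f i) :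
    ENNReal.ofReal (∑' i, f i) ≤ ∑' i, ENNReal.ofReal (f i) := by
  by_cases h : Summable f
  · rw [ENNReal.ofReal_tsum_of_nonneg hf h]
  · rw [tsum_eq_zero_of_not_summable h]; simp

lemma ofReal_integral_le {f : ℝ → ℝ} (hf : ∀ i, 0 ≤ f i) :
    ENNReal.ofReal (∫ t, f t) ≤ ∫⁻ t, ENNReal.ofReal (f t) := by
  by_cases h : Integrable f
  · rw [ofReal_integral_eq_lintegral_ofReal h (ae_of_all _ hf)]
  · rw [integral_undef h]; simp

lemma l2sq_nonneg (v : ℤ → ℂ) : 0 ≤ l2sq v := tsum_nonneg fun _ => by positivity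

lemma ofReal_sq_norm (z : ℂ) : ENNReal.ofReal (‖z‖ ^ 2) = ‖z‖ₑ ^ 2 := by
  rw [ENNReal.ofReal_pow (norm_nonneg _), ofReal_norm]

lemma ofReal_L2full (W : ℝ → ℤ → ℂ) :
    ENNReal.ofReal (L2full W) = ENNReal.ofReal (∫ t, l2sq (W t)) ^ ((1:ℝ)/2) := by
  rw [L2full, ENNReal.ofReal_rpow_of_nonneg (integral_nonneg fun t => l2sq_nonneg _)
    (by norm_num)]

/-- The normalising constant. -/
def cpi : ℝ≥0∞ := ENNReal.ofReal ((2 * π)⁻¹) ^ ((1:ℝ)/2)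

lemma rpow_half_aux (x : ℝ≥0∞) :
    (ENNReal.ofReal ((2 * π)⁻¹) * x ^ 2) ^ ((1:ℝ)/2) = cpi * x := by
  rw [ENNReal.mul_rpow_of_nonneg _ _ (by norm_num), cpi, ← ENNReal.rpow_natCast,
    ← ENNReal.rpow_mul]
  norm_num

lemma L2full_QL_le {χ p : ℝ → ℝ} (hχ : CutoffFun χ) (n : ℕ) {U : ℝ → ℤ → ℂ}
    (hU : ∀ ξ, Integrable fun t => U t ξ) :
    ENNReal.ofReal (L2full (QL χ p (dy n) U)) ≤
      cpi * nrm (fun ξ τ => ‖lpSymb χ (dy n) τ‖ₑ * shG p U ξ τ) := by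
  rw [← rpow_half_aux, ← lint_QL hχ n hU, ofReal_L2full]
  gcongr
  refine (ofReal_integral_le fun t => l2sq_nonneg _).trans (lintegral_mono fun t => ?_)
  refine (ofReal_tsum_le fun ξ => by positivity).trans (le_of_eq ?_)
  simp_rw [ofReal_sq_norm]

lemma L2full_QL_eq {χ p : ℝ → ℝ} (hχ : CutoffFun χ) (n : ℕ) {U : ℝ → ℤ → ℂ}
    (hU : ∀ ξ, Integrable fun t => U t ξ)
    (hs : ∀ t : ℝ, Summable fun ξ : ℤ => ‖QL χ p (dy n) U t ξ‖ ^ 2)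
    (hi : Integrable (fun t : ℝ => l2sq (QL χ p (dy n) U t))) :
    ENNReal.ofReal (L2full (QL χ p (dy n) U)) =
      cpi * nrm (fun ξ τ => ‖lpSymb χ (dy n) τ‖ₑ * shG p U ξ τ) := by
  rw [← rpow_half_aux, ← lint_QL hχ n hU, ofReal_L2full,
    ofReal_integral_eq_lintegral_ofReal hi (ae_of_all _ fun t => l2sq_nonneg _)]
  congr 1
  refine lintegral_congr fun t => ?_
  rw [l2sq, ENNReal.ofReal_tsum_of_nonneg (fun ξ => by positivity) (hs t)]
  simp_rw [ofReal_sq_norm]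

lemma L2full_nonneg (W : ℝ → ℤ → ℂ) : 0 ≤ L2full W :=
  Real.rpow_nonneg (integral_nonneg fun t => l2sq_nonneg _) _

lemma ofReal_weight (l : ℕ) : ENNReal.ofReal (((2:ℝ) ^ l) ^ ((1:ℝ)/2)) = rt ^ l := by
  rw [rt, ← ENNReal.ofReal_pow (by positivity), Real.sqrt_eq_rpow, ← Real.rpow_natCast,
    ← Real.rpow_natCast, ← Real.rpow_mul (by norm_num), ← Real.rpow_mul (by norm_num), mul_comm]

lemma dy_zero : dy 0 = 0 := by simp [dy]

lemma dy_succ (l : ℕ) : dy (l + 1) = 2 ^ l := by simp [dy]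

lemma one_le_rt : 1 ≤ rt := by
  rw [rt, ENNReal.one_le_ofReal]
  exact Real.one_le_sqrt.mpr (by norm_num)

lemma Xhalf_le (χ p : ℝ → ℝ) (U : ℝ → ℤ → ℂ) :
    ENNReal.ofReal (Xhalf χ p U) ≤ ∑' n, rt ^ n * ENNReal.ofReal (L2full (QL χ p (dy n) U)) := by
  rw [Xhalf]
  refine ENNReal.ofReal_add_le.trans ?_
  rw [tsum_eq_zero_add' ENNReal.summable]
  gcongr
  · simp [dy_zero]
  · refine (ofReal_tsum_le fun l => mul_nonneg (by positivity) (L2full_nonneg _)).trans ?_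
    refine ENNReal.tsum_le_tsum fun l => ?_
    rw [ENNReal.ofReal_mul (by positivity), ofReal_weight, dy_succ]
    gcongr
    · exact one_le_rt
    · omega

lemma le_Xhalf (χ p : ℝ → ℝ) (U : ℝ → ℤ → ℂ)
    (hs : Summable (fun l : ℕ => ((2:ℝ) ^ l) ^ ((1:ℝ)/2) * L2full (QL χ p ((2:ℝ) ^ l) U))) :
    ∑' n, rt ^ n * ENNReal.ofReal (L2full (QL χ p (dy n) U)) ≤
      rt * ENNReal.ofReal (Xhalf χ p U) := by
  have hnn : ∀ l : ℕ, 0 ≤ ((2:ℝ) ^ l) ^ ((1:ℝ)/2) * L2full (QL χ p ((2:ℝ) ^ l) U) :=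
    fun l => mul_nonneg (by positivity) (L2full_nonneg _)
  rw [Xhalf, ENNReal.ofReal_add (L2full_nonneg _) (tsum_nonneg hnn),
    ENNReal.ofReal_tsum_of_nonneg hnn hs, tsum_eq_zero_add' ENNReal.summable, mul_add,
    ← ENNReal.tsum_mul_left, dy_zero, pow_zero]
  gcongr ?_ * _ + ?_
  · exact one_le_rt
  · refine ENNReal.tsum_le_tsum fun l => le_of_eq ?_
    rw [ENNReal.ofReal_mul (by positivity), ofReal_weight, dy_succ]
    ring

/-- Lemma `lem_short1`, estimate (short2):
`‖χ(Lt)u‖_{X^{0,1/2,1}} ≤ C ‖u‖_{X^{0,1/2,1}}` for dyadic `L ≥ 1`. -/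
theorem short_time_X_estimate
    (α ξ₀ c₀ C₀ : ℝ) (hα : α ∈ Set.Icc (1:ℝ) 2)
    (p : ℝ → ℝ) (hp : Hyp1 α ξ₀ c₀ C₀ p)
    (χ : ℝ → ℝ) (hχ : CutoffFun χ) :
    ∃ C : ℝ, 0 < C ∧
      ∀ (U : ℝ → ℤ → ℂ), MemX χ p U →
      ∀ l : ℕ,
        Xhalf χ p (fun t ξ => (χ (((2:ℝ) ^ l) * t) : ℂ) * U t ξ) ≤
          C * Xhalf χ p U := by
  obtain ⟨H, D, hHc, hHi, hD, hH1, hH2, hr⟩ := cutoff_repr hχ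
  set A : ℝ≥0∞ := ENNReal.ofReal (128 * π * D) + ∫⁻ v, ‖H v‖ₑ with hA
  have hAtop : A ≠ ⊤ := ENNReal.add_ne_top.mpr ⟨ENNReal.ofReal_ne_top, hHi.2.ne⟩
  set B : ℝ≥0∞ := (4 * rt ^ 4 * A + 6 * A) * rt with hB
  have hBtop : B ≠ ⊤ := by
    have h4 : rt ^ 4 ≠ ⊤ := ENNReal.pow_ne_top rt_ne_top
    exact ENNReal.mul_ne_top (ENNReal.add_ne_top.mpr
      ⟨ENNReal.mul_ne_top (ENNReal.mul_ne_top (by norm_num) h4) hAtop,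
        ENNReal.mul_ne_top (by norm_num) hAtop⟩) rt_ne_top
  refine ⟨B.toReal + 1, by positivity, ?_⟩
  intro U hU l
  obtain ⟨hUm, hUi, hs0, hsl, hi0, hil, hsum⟩ := hU
  have hX0 : 0 ≤ Xhalf χ p U :=
    add_nonneg (L2full_nonneg _)
      (tsum_nonneg fun l => mul_nonneg (by positivity) (L2full_nonneg _))
  set V : ℝ → ℤ → ℂ := fun t ξ => (χ (((2:ℝ) ^ l) * t) : ℂ) * U t ξ with hV
  have hχc : Continuous χ := hχ.smooth.continuous
  have hVi : ∀ ξ, Integrable fun t => V t ξ := by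
    intro ξ
    refine (hUi ξ).bdd_mul (c := 1) ?_ ?_
    · exact (by fun_prop : Continuous fun t : ℝ =>
        (χ (((2:ℝ) ^ l) * t) : ℂ)).aestronglyMeasurable
    · refine ae_of_all _ fun t => ?_
      rw [Complex.norm_real, Real.norm_eq_abs, abs_of_nonneg (hχ.nonneg _)]
      exact hχ.le_one _
  have hcore := core_bound (k := kern H l) (a := fun n τ => ‖lpSymb χ (dy n) τ‖ₑ)
    (F := shG p V) (G := shG p U) (A := A) l (kern_measurable hHc l)
    (fun n => (lpSymb_continuous hχ n).measurable.enorm)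
    (fun ξ => ((continuous_FT (hUi ξ)).comp (continuous_add_const (p ξ))).measurable.enorm)
    (fun n τ => by
      rw [← ofReal_norm, ENNReal.ofReal_le_one]; exact lpSymb_abs_le hχ n τ)
    (lpSymb_tsum hχ)
    (fun n τ h => lpSymb_up hχ n τ (by simpa using h))
    (fun n τ h => lpSymb_low hχ n τ (by simpa using h))
    (by rw [kern_integral]; exact le_add_self)
    (fun σ => (kern_bound1 hD hH1 l σ).trans (by gcongr; exact le_self_add))
    (fun n σ h => (kern_bound2 hD hH2 l n σ h).trans (by gcongr; exact le_self_add))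
    (fun ξ τ => FT_cutoff_le hHi hr l (hUi ξ) (p ξ) τ)
  have hfin : ENNReal.ofReal (Xhalf χ p V) ≤ B * ENNReal.ofReal (Xhalf χ p U) := by
    calc _ ≤ ∑' n, rt ^ n * ENNReal.ofReal (L2full (QL χ p (dy n) V)) := Xhalf_le χ p V
      _ ≤ ∑' n, cpi * (rt ^ n * nrm (fun ξ τ => ‖lpSymb χ (dy n) τ‖ₑ * shG p V ξ τ)) := by
          refine ENNReal.tsum_le_tsum fun n => ?_
          rw [mul_left_comm]
          gcongr
          exact L2full_QL_le hχ n hVi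
      _ = cpi * ∑' n, rt ^ n * nrm (fun ξ τ => ‖lpSymb χ (dy n) τ‖ₑ * shG p V ξ τ) :=
          ENNReal.tsum_mul_left
      _ ≤ cpi * ((4 * rt ^ 4 * A + 6 * A) *
            ∑' n, rt ^ n * nrm (fun ξ τ => ‖lpSymb χ (dy n) τ‖ₑ * shG p U ξ τ)) := by
          gcongr
      _ = (4 * rt ^ 4 * A + 6 * A) *
            ∑' n, rt ^ n * ENNReal.ofReal (L2full (QL χ p (dy n) U)) := by
          rw [mul_left_comm, ← ENNReal.tsum_mul_left]
          congr 1
          refine tsum_congr fun n => ?_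
          rw [L2full_QL_eq hχ n hUi, mul_left_comm]
          · cases n with
            | zero => rw [dy_zero]; exact hs0
            | succ n => rw [dy_succ]; exact hsl n
          · cases n with
            | zero => rw [dy_zero]; exact hi0
            | succ n => rw [dy_succ]; exact hil n
      _ ≤ (4 * rt ^ 4 * A + 6 * A) * (rt * ENNReal.ofReal (Xhalf χ p U)) := by
          gcongr
          exact le_Xhalf χ p U hsum
      _ = _ := by rw [hB]; ring
  rw [← ENNReal.ofReal_toReal hBtop, ← ENNReal.ofReal_mul ENNReal.toReal_nonneg,
    ENNReal.ofReal_le_ofReal_iff (by positivity)] at hfin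
  refine hfin.trans ?_
  gcongr
  linarith

end
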